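/- Let q be a power of an odd prime, f ∈ 𝔽_q[X] square-free of degree 3, and let D consist of n pairwise distinct affine points P_i = (α_i, β_i) of y² = f(x) with β_i ≠ 0 for all i, where n = 2s is even. Let k be even with 4 ≤ k ≤ n−2, η ∈ 𝔽_q^*, v ∈ (𝔽_q^*)^n, and let γ ∈ (𝔽_q^*)^n satisfy the first-type residue relations for D. Set A = Σ_{i=1}^n γ_i α_i^{s−1} and B = Σ_{i=1}^n γ_i α_i^{s−2} β_i, and assume (A, B) ≠ (0, 0). Put f₂(x, y) = ηA·x^{s−k/2−1}·y − (A + ηB)·x^{s−k/2}. Then the dual code C(D, kO, k/2, η, v)^⊥ of the twisted generalized elliptic curve code equals the 𝔽_q-span of the n−k vectors (γ_i·f₂(α_i, β_i)/(v_i·β_i))_{i=1}^n, (γ_i·α_i^a/(v_i·β_i))_{i=1}^n for 0 ≤ a ≤ (n−k−2)/2, and (γ_i·α_i^b/v_i)_{i=1}^n for 0 ≤ b ≤ (n−k−4)/2. -/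

import Mathlib

open Polynomial

/-- A function `c(x) + d(x) y` of small degree vanishing at many points of `y² = f(x)` is zero:
compare the roots of its norm `c² - d² f`, counted with multiplicity, with the degree. -/
theorem eq_zero_of_forall_eval_add_eval_mul_eq_zero {F ι : Type*} [Field F] [Fintype ι]
    (h2 : (2 : F) ≠ 0) {f : F[X]} (hf : Odd f.natDegree) {α β : ι → F}
    (hdist : Function.Injective fun i => (α i, β i)) (hβ : ∀ i, β i ≠ 0)
    (hcurve : ∀ i, β i ^ 2 = f.eval (α i)) {c d : F[X]}
    (hc : 2 * c.natDegree < Fintype.card ι)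
    (hd : 2 * d.natDegree + f.natDegree < Fintype.card ι)
    (h : ∀ i, c.eval (α i) + d.eval (α i) * β i = 0) : c = 0 ∧ d = 0 := by
  classical
  have hf0 : f ≠ 0 := by
    rintro rfl
    simp at hf
  have hneg : ∀ {i j}, i ≠ j → α i = α j → β j = -β i := by
    intro i j hij hα
    have hsq : β j ^ 2 = β i ^ 2 := by rw [hcurve, hcurve, hα]
    refine (sq_eq_sq_iff_eq_or_eq_neg.mp hsq).resolve_left fun hβij => hij (hdist ?_)
    simp [hα, hβij]
  have hN : c ^ 2 - d ^ 2 * f = 0 := by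
    by_contra hN
    have hle : Finset.univ.val.map α ≤ (c ^ 2 - d ^ 2 * f).roots := by
      refine Multiset.le_iff_count.mpr fun a => ?_
      rw [count_roots, Multiset.count_map, le_rootMultiplicity_iff hN]
      rw [← Finset.filter_val, Finset.card_val]
      set S := Finset.univ.filter fun i => a = α i with hS
      have hmem : ∀ {i}, i ∈ S ↔ a = α i := by simp [hS]
      rcases Nat.lt_or_ge 1 S.card with h1 | h1
      · obtain ⟨i, hi, j, hj, hij⟩ := Finset.one_lt_card.mp h1
        have hcard : S.card ≤ 2 := by
          by_contra! h3
          obtain ⟨x, y, z, hx, hy, hz, hxy, hxz, hyz⟩ := Finset.two_lt_card_iff.mp h3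
          rw [hmem] at hx hy hz
          have e1 := hneg hxy (hx.symm.trans hy)
          have e2 := hneg hxz (hx.symm.trans hz)
          exact hyz (hdist (by simp [e1, e2, ← hy, ← hz]))
        rw [hmem] at hi hj
        have hji := hneg hij (hi.symm.trans hj)
        have ei := h i
        have ej := h j
        rw [← hi] at ei
        rw [← hj, hji] at ej
        have hd0 : d.eval a = 0 := by
          have : 2 * β i * d.eval a = 0 := by linear_combination ei - ej
          simpa [h2, hβ i] using this
        have hc0 : c.eval a = 0 := by simpa [hd0] using ei
        have hcd := dvd_iff_isRoot.mpr hc0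
        have hdd := dvd_iff_isRoot.mpr hd0
        exact (pow_dvd_pow _ hcard).trans
          (dvd_sub (pow_dvd_pow_of_dvd hcd 2) ((pow_dvd_pow_of_dvd hdd 2).mul_right f))
      · rcases Finset.eq_empty_or_nonempty S with h0 | ⟨i, hi⟩
        · simp [h0]
        · refine (pow_dvd_pow _ h1).trans ?_
          rw [pow_one, dvd_iff_isRoot, IsRoot.def]
          rw [hmem] at hi
          have ei := h i
          have hci := hcurve i
          rw [← hi] at ei hci
          simp only [eval_sub, eval_mul, eval_pow, ← hci]
          linear_combination (c.eval a - d.eval a * β i) * ei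
    have hcard := (Multiset.card_le_card hle).trans (card_roots' _)
    rw [Multiset.card_map, Finset.card_val, Finset.card_univ] at hcard
    have hdeg : (c ^ 2 - d ^ 2 * f).natDegree ≤
        max (2 * c.natDegree) (2 * d.natDegree + f.natDegree) :=
      (natDegree_sub_le _ _).trans <| max_le_max natDegree_pow_le <|
        natDegree_mul_le.trans <| Nat.add_le_add_right natDegree_pow_le _
    omega
  have hcd : c ^ 2 = d ^ 2 * f := sub_eq_zero.mp hN
  by_cases hd0 : d = 0
  · subst hd0
    simpa using hcd
  · have hdeg := congrArg natDegree hcd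
    rw [natDegree_mul (pow_ne_zero 2 hd0) hf0, natDegree_pow, natDegree_pow] at hdeg
    obtain ⟨e, he⟩ := hf
    omega

/-- If two linearly independent families are mutually orthogonal and their cardinalities add up to
the dimension, then the second one spans the dual code of the span of the first one. -/
theorem setOf_orthogonal_span_range_eq_span_range {F m ι κ : Type*} [Field F]
    [Fintype m] [Fintype ι] [Fintype κ] {b : ι → m → F} {h : κ → m → F}
    (hb : LinearIndependent F b) (hh : LinearIndependent F h)
    (hort : ∀ x y, ∑ i, h y i * b x i = 0)
    (hcard : Fintype.card ι + Fintype.card κ = Fintype.card m) :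
    {u : m → F | ∀ c ∈ Submodule.span F (Set.range b), ∑ i, u i * c i = 0} =
      (Submodule.span F (Set.range h) : Set (m → F)) := by
  classical
  have hker : {u : m → F | ∀ c ∈ Submodule.span F (Set.range b), ∑ i, u i * c i = 0} =
      (LinearMap.ker (Matrix.mulVecLin (Matrix.of b)) : Set (m → F)) := by
    ext u
    simp only [Set.mem_ofPred_eq, SetLike.mem_coe, LinearMap.mem_ker, Matrix.mulVecLin_apply]
    constructor
    · intro hu
      ext x
      simpa [Matrix.mulVec, dotProduct, mul_comm] using
        hu _ (Submodule.subset_span (Set.mem_range_self x))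
    · intro hu c hc
      induction hc using Submodule.span_induction with
      | mem c hc =>
        obtain ⟨x, rfl⟩ := hc
        simpa [Matrix.mulVec, dotProduct, mul_comm] using congrFun hu x
      | zero => simp
      | add c d _ _ hc hd => simp [mul_add, Finset.sum_add_distrib, hc, hd]
      | smul a c _ hc => simp [mul_left_comm, ← Finset.mul_sum, hc]
  rw [hker]
  congr 1
  symm
  refine Submodule.eq_of_le_of_finrank_eq ?_ ?_
  · rw [Submodule.span_le, ← hker]
    rintro _ ⟨y, rfl⟩ c hc
    induction hc using Submodule.span_induction with
    | mem c hc =>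
      obtain ⟨x, rfl⟩ := hc
      exact hort x y
    | zero => simp
    | add c d _ _ hc hd => simp [mul_add, Finset.sum_add_distrib, hc, hd]
    | smul a c _ hc => simp [mul_left_comm, ← Finset.mul_sum, hc]
  · have hrank : Module.finrank F (LinearMap.range (Matrix.mulVecLin (Matrix.of b))) =
        Fintype.card ι := LinearIndependent.rank_matrix (M := Matrix.of b) hb
    have := LinearMap.finrank_range_add_finrank_ker (Matrix.mulVecLin (Matrix.of b))
    rw [Module.finrank_fintype_fun_eq_card] at this
    rw [finrank_span_eq_card hh]
    omega

theorem natDegree_sum_fin_C_mul_X_pow_le {R : Type*} [Semiring R] {N M : ℕ} (g : Fin N → R)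
    (h : N ≤ M + 1) : (∑ a, C (g a) * X ^ (a : ℕ)).natDegree ≤ M :=
  natDegree_sum_le_of_forall_le _ _ fun a _ =>
    (natDegree_C_mul_X_pow_le _ _).trans (by omega)

theorem coeff_sum_fin_C_mul_X_pow {R : Type*} [Semiring R] {N : ℕ} (g : Fin N → R) (a : Fin N) :
    (∑ x, C (g x) * X ^ (x : ℕ)).coeff a = g a := by
  simp [coeff_C_mul, coeff_X_pow, Fin.val_inj]

theorem coeff_sum_fin_C_mul_X_pow_eq_zero {R : Type*} [Semiring R] {N M : ℕ} (g : Fin N → R)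
    (h : N ≤ M) : (∑ x, C (g x) * X ^ (x : ℕ)).coeff M = 0 := by
  simp only [finsetSum_coeff, coeff_C_mul, coeff_X_pow]
  exact Finset.sum_eq_zero fun x _ => by rw [if_neg (by omega), mul_zero]

theorem stmt_7 (F : Type*) [Field F] [Fintype F] (hchar : ringChar F ≠ 2)
    (f : F[X]) (hsf : Squarefree f) (hdeg : f.natDegree = 3)
    (n s : ℕ) (hn : n = 2 * s)
    (α β : Fin n → F)
    (hdist : Function.Injective (fun i => (α i, β i)))
    (hβ0 : ∀ i, β i ≠ 0)
    (hcurve : ∀ i, β i ^ 2 = f.eval (α i))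
    (k : ℕ) (hk : Even k) (hk4 : 4 ≤ k) (hkn : k ≤ n - 2)
    (η : F) (hη : η ≠ 0)
    (v γ : Fin n → F) (hv : ∀ i, v i ≠ 0) (hγ : ∀ i, γ i ≠ 0)
    (hres1 : ∀ j : ℕ, 2 * j ≤ n → ∑ i, γ i * α i ^ j / β i = 0)
    (hres2 : ∀ j : ℕ, 2 * j ≤ n - 4 → ∑ i, γ i * α i ^ j = 0)
    (hres3 : ∀ j : ℕ, 2 * j ≤ n - 6 → ∑ i, γ i * α i ^ j * β i = 0)
    (A B : F)
    (hA : A = ∑ i, γ i * α i ^ (s - 1))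
    (hB : B = ∑ i, γ i * α i ^ (s - 2) * β i)
    (hAB : ¬(A = 0 ∧ B = 0))
    (C : Submodule F (Fin n → F))
    (hC : C = Submodule.span F (Set.range (Sum.elim
      (fun (a : Fin (k / 2 + 1)) => fun i => v i * (α i ^ (a : ℕ) +
        if (a : ℕ) = k / 2 then η * α i ^ ((k - 2) / 2) * β i else 0))
      (fun (b : Fin ((k - 4) / 2 + 1)) => fun i => v i * α i ^ (b : ℕ) * β i))))
    (H : Submodule F (Fin n → F))
    (hH : H = Submodule.span F (Set.range (Sum.elim
      (fun (_ : Fin 1) => fun i => γ i * (η * A * α i ^ (s - k / 2 - 1) * β i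
        - (A + η * B) * α i ^ (s - k / 2)) / (v i * β i))
      (Sum.elim
        (fun (a : Fin ((n - k - 2) / 2 + 1)) => fun i => γ i * α i ^ (a : ℕ) / (v i * β i))
        (fun (b : Fin ((n - k - 2) / 2)) => fun i => γ i * α i ^ (b : ℕ) / v i))))) :
    {u : Fin n → F | ∀ c ∈ C, ∑ i, u i * c i = 0} = (H : Set (Fin n → F)) := by
  have h2 : (2 : F) ≠ 0 := Ring.two_ne_zero hchar
  have hodd : Odd f.natDegree := hdeg ▸ by decide
  obtain ⟨r, hr⟩ : ∃ r, k = 2 * (r + 2) := by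
    obtain ⟨m, hm⟩ := hk
    exact ⟨m - 2, by omega⟩
  obtain ⟨t, rfl⟩ : ∃ t, s = r + t + 3 := ⟨s - (r + 3), by omega⟩
  have e1 : k / 2 = r + 2 := by omega
  have e2 : (k - 2) / 2 = r + 1 := by omega
  have e3 : (k - 4) / 2 = r := by omega
  have e4 : (n - k - 2) / 2 = t := by omega
  have e5 : r + t + 3 - (r + 2) = t + 1 := by omega
  have e6 : r + t + 3 - 1 = r + t + 2 := by omega
  have e7 : r + t + 3 - 2 = r + t + 1 := by omega
  rw [e1, e2, e3] at hC
  rw [e1, e4, e5, Nat.add_sub_cancel] at hH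
  rw [e6] at hA
  rw [e7] at hB
  replace hres1 : ∀ j ≤ r + t + 3, ∑ i, γ i * α i ^ j / β i = 0 :=
    fun j hj => hres1 j (by omega)
  replace hres2 : ∀ j ≤ r + t + 1, ∑ i, γ i * α i ^ j = 0 := fun j hj => hres2 j (by omega)
  replace hres3 : ∀ j ≤ r + t, ∑ i, γ i * α i ^ j * β i = 0 := fun j hj => hres3 j (by omega)
  have hzero : ∀ {c d : F[X]}, c.natDegree ≤ r + t + 2 → d.natDegree ≤ r + t + 1 →
      (∀ i, c.eval (α i) + d.eval (α i) * β i = 0) → c = 0 ∧ d = 0 := fun hc hd =>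
    eq_zero_of_forall_eval_add_eval_mul_eq_zero h2 hodd hdist hβ0 hcurve
      (by rw [Fintype.card_fin]; omega) (by rw [Fintype.card_fin]; omega)
  rw [hC, hH]
  refine setOf_orthogonal_span_range_eq_span_range ?_ ?_ ?_ ?_
  · rw [Fintype.linearIndependent_iff]
    intro g hg
    have key := hzero (c := ∑ a, Polynomial.C (g (Sum.inl a)) * X ^ (a : ℕ))
      (d := (∑ b, Polynomial.C (g (Sum.inr b)) * X ^ (b : ℕ)) +
        Polynomial.C (η * g (Sum.inl (Fin.last (r + 2)))) * X ^ (r + 1))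
      (natDegree_sum_fin_C_mul_X_pow_le _ (by omega))
      (natDegree_add_le_of_degree_le (natDegree_sum_fin_C_mul_X_pow_le _ (by omega))
        ((natDegree_C_mul_X_pow_le _ _).trans (by omega))) ?_
    · obtain ⟨hc, hd⟩ := key
      have hl : ∀ a, g (Sum.inl a) = 0 := fun a => by
        rw [← coeff_sum_fin_C_mul_X_pow (fun a => g (Sum.inl a)) a, hc, coeff_zero]
      rw [hl, mul_zero, Polynomial.C_0, zero_mul, add_zero] at hd
      rintro (a | b)
      · exact hl a
      · rw [← coeff_sum_fin_C_mul_X_pow (fun b => g (Sum.inr b)) b, hd, coeff_zero]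
    · intro i
      have hi := congrFun hg i
      simp only [Fintype.sum_sum_type, Finset.sum_apply, Pi.smul_apply, Sum.elim_inl,
        Sum.elim_inr, smul_eq_mul, Pi.zero_apply] at hi
      simp only [eval_finsetSum, eval_add, eval_mul, eval_C, eval_pow, eval_X]
      refine (mul_eq_zero.mp (Eq.trans ?_ hi)).resolve_left (hv i)
      rw [Fin.sum_univ_castSucc, Fin.sum_univ_castSucc (n := r + 2)]
      have hlt : ∀ a : Fin (r + 2), (a : ℕ) ≠ r + 2 := fun a => a.isLt.ne
      simp only [Fin.val_castSucc, Fin.val_last, hlt, if_true, if_false, add_zero, mul_add, add_mul,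
        Finset.mul_sum, Finset.sum_mul]
      have E1 : ∀ a : Fin (r + 2), v i * (g (Sum.inl a.castSucc) * α i ^ (a : ℕ)) =
        g (Sum.inl a.castSucc) * (v i * α i ^ (a : ℕ)) := fun a => by ring
      have E2 : ∀ b : Fin (r + 1), v i * (g (Sum.inr b) * α i ^ (b : ℕ) * β i) =
        g (Sum.inr b) * (v i * α i ^ (b : ℕ) * β i) := fun b => by ring
      simp only [E1, E2]
      ring
  · rw [Fintype.linearIndependent_iff]
    intro g hg
    have key := hzero
      (c := (∑ a, Polynomial.C (g (Sum.inr (Sum.inl a))) * X ^ (a : ℕ)) +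
        Polynomial.C (-(g (Sum.inl 0) * (A + η * B))) * X ^ (t + 1))
      (d := (∑ b, Polynomial.C (g (Sum.inr (Sum.inr b))) * X ^ (b : ℕ)) +
        Polynomial.C (g (Sum.inl 0) * (η * A)) * X ^ t)
      (natDegree_add_le_of_degree_le (natDegree_sum_fin_C_mul_X_pow_le _ (by omega))
        ((natDegree_C_mul_X_pow_le _ _).trans (by omega)))
      (natDegree_add_le_of_degree_le (natDegree_sum_fin_C_mul_X_pow_le _ (by omega))
        ((natDegree_C_mul_X_pow_le _ _).trans (by omega))) ?_
    · obtain ⟨hc, hd⟩ := key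
      have hc' := congrArg (coeff · (t + 1)) hc
      have hd' := congrArg (coeff · t) hd
      simp only [coeff_add, coeff_sum_fin_C_mul_X_pow_eq_zero _ le_rfl, coeff_C_mul_X_pow, if_true,
        coeff_zero, zero_add] at hc' hd'
      have h0 : g (Sum.inl 0) = 0 := by
        by_contra h0
        have hA0 : A = 0 := by simpa [h0, hη] using hd'
        have hB0 : B = 0 := by simpa [h0, hη, hA0] using hc'
        exact hAB ⟨hA0, hB0⟩
      simp only [h0, zero_mul, neg_zero, Polynomial.C_0, add_zero] at hc hd
      rintro (a | a | b)
      · rw [Subsingleton.elim a 0, h0]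
      · rw [← coeff_sum_fin_C_mul_X_pow (fun a => g (Sum.inr (Sum.inl a))) a, hc, coeff_zero]
      · rw [← coeff_sum_fin_C_mul_X_pow (fun b => g (Sum.inr (Sum.inr b))) b, hd, coeff_zero]
    · intro i
      have hi := congrFun hg i
      have hvi := hv i
      have hβi := hβ0 i
      simp only [Fintype.sum_sum_type, Finset.sum_apply, Pi.smul_apply, Sum.elim_inl,
        Sum.elim_inr, smul_eq_mul, Pi.zero_apply, Fin.sum_univ_one] at hi
      simp only [eval_finsetSum, eval_add, eval_mul, eval_C, eval_pow, eval_X]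
      refine (mul_eq_zero.mp (Eq.trans ?_ hi)).resolve_left
        (div_ne_zero (hγ i) (mul_ne_zero hvi hβi))
      simp only [mul_add, add_mul, Finset.mul_sum, Finset.sum_mul]
      have E1 : ∀ a : Fin (t + 1),
          γ i / (v i * β i) * (g (Sum.inr (Sum.inl a)) * α i ^ (a : ℕ)) =
          g (Sum.inr (Sum.inl a)) * (γ i * α i ^ (a : ℕ) / (v i * β i)) := fun a => by ring
      have E2 : ∀ b : Fin t,
          γ i / (v i * β i) * (g (Sum.inr (Sum.inr b)) * α i ^ (b : ℕ) * β i) =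
          g (Sum.inr (Sum.inr b)) * (γ i * α i ^ (b : ℕ) / v i) := fun b => by field_simp
      simp only [E1, E2]
      ring
  · rintro (a | b) (z | a' | b')
    · have ha := a.isLt
      simp only [Sum.elim_inl]
      split_ifs with h
      · rw [h]
        have e : ∀ i, γ i * (η * A * α i ^ t * β i - (A + η * B) * α i ^ (t + 1)) / (v i * β i) *
            (v i * (α i ^ (r + 2) + η * α i ^ (r + 1) * β i)) =
            (η * A - η * (A + η * B)) * (γ i * α i ^ (r + t + 2)) +
            η ^ 2 * A * (γ i * α i ^ (r + t + 1) * β i) -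
            (A + η * B) * (γ i * α i ^ (r + t + 3) / β i) := fun i => by
          have hvi := hv i
          have hβi := hβ0 i
          field_simp
          ring
        simp only [e, Finset.sum_add_distrib, Finset.sum_sub_distrib, ← Finset.mul_sum, ← hA, ← hB,
          hres1 _ le_rfl]
        ring
      · have e : ∀ i, γ i * (η * A * α i ^ t * β i - (A + η * B) * α i ^ (t + 1)) / (v i * β i) *
            (v i * (α i ^ (a : ℕ) + 0)) = η * A * (γ i * α i ^ (t + a)) -
            (A + η * B) * (γ i * α i ^ (t + 1 + a) / β i) := fun i => by
          have hvi := hv i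
          have hβi := hβ0 i
          field_simp
          ring
        simp only [e, Finset.sum_sub_distrib, ← Finset.mul_sum, hres1 (t + 1 + a) (by omega),
          hres2 (t + a) (by omega)]
        ring
    · have ha := a.isLt
      have ha' := a'.isLt
      simp only [Sum.elim_inl, Sum.elim_inr]
      split_ifs with h
      · rw [h]
        have e : ∀ i, γ i * α i ^ (a' : ℕ) / (v i * β i) *
            (v i * (α i ^ (r + 2) + η * α i ^ (r + 1) * β i)) =
            γ i * α i ^ (r + 2 + a') / β i + η * (γ i * α i ^ (r + 1 + a')) := fun i => by
          have hvi := hv i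
          have hβi := hβ0 i
          field_simp
          ring
        simp only [e, Finset.sum_add_distrib, ← Finset.mul_sum, hres1 (r + 2 + a') (by omega),
          hres2 (r + 1 + a') (by omega)]
        ring
      · simp only [add_zero]
        rw [← hres1 (a' + a) (by omega)]
        refine Finset.sum_congr rfl fun i _ => ?_
        have hvi := hv i
        have hβi := hβ0 i
        field_simp
        ring
    · have ha := a.isLt
      have hb' := b'.isLt
      simp only [Sum.elim_inl, Sum.elim_inr]
      split_ifs with h
      · rw [h]
        have e : ∀ i, γ i * α i ^ (b' : ℕ) / v i *
            (v i * (α i ^ (r + 2) + η * α i ^ (r + 1) * β i)) =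
            γ i * α i ^ (r + 2 + b') + η * (γ i * α i ^ (r + 1 + b') * β i) := fun i => by
          have hvi := hv i
          field_simp
          ring
        simp only [e, Finset.sum_add_distrib, ← Finset.mul_sum, hres2 (r + 2 + b') (by omega),
          hres3 (r + 1 + b') (by omega)]
        ring
      · simp only [add_zero]
        rw [← hres2 (b' + a) (by omega)]
        refine Finset.sum_congr rfl fun i _ => ?_
        have hvi := hv i
        field_simp
        ring
    · have hb := b.isLt
      simp only [Sum.elim_inl, Sum.elim_inr]
      have e : ∀ i, γ i * (η * A * α i ^ t * β i - (A + η * B) * α i ^ (t + 1)) / (v i * β i) *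
          (v i * α i ^ (b : ℕ) * β i) = η * A * (γ i * α i ^ (t + b) * β i) -
          (A + η * B) * (γ i * α i ^ (t + 1 + b)) := fun i => by
        have hvi := hv i
        have hβi := hβ0 i
        field_simp
        ring
      simp only [e, Finset.sum_sub_distrib, ← Finset.mul_sum, hres2 (t + 1 + b) (by omega),
        hres3 (t + b) (by omega)]
      ring
    · have hb := b.isLt
      have ha' := a'.isLt
      simp only [Sum.elim_inl, Sum.elim_inr]
      rw [← hres2 (a' + b) (by omega)]
      refine Finset.sum_congr rfl fun i _ => ?_
      have hvi := hv i
      have hβi := hβ0 i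
      field_simp
      ring
    · have hb := b.isLt
      have hb' := b'.isLt
      simp only [Sum.elim_inr]
      rw [← hres3 (b' + b) (by omega)]
      refine Finset.sum_congr rfl fun i _ => ?_
      have hvi := hv i
      field_simp
      ring
  · simp only [Fintype.card_sum, Fintype.card_fin]
    omega
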